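/- Agreement of canonical solutions across sectors without Stokes rays (case G = GLₙ(ℂ)): let r and r′ be admissible rays with r ≠ −r′ such that no Stokes ray ℝ_{>0}·(z_i − z_j) (i ≠ j) is contained in Σ̄(r,r′). Let Y_r : H_r → GLₙ(ℂ) and Y_{r′} : H_{r′} → GLₙ(ℂ) be the canonical fundamental solutions, i.e. the unique holomorphic maps satisfying Y′(t) = (Z/t² + f/t)·Y(t) and Y(t)·exp(Z/t) → 1 as t → 0 within the respective half-planes. Then Y_r(t) = Y_{r′}(t) for all t ∈ H_r ∩ H_{r′}. -/

import Mathlib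

open Complex Filter Topology

/-- The ray `ℝ_{>0}·c` through a point `c ∈ ℂ`. -/
def rayThrough (c : ℂ) : Set ℂ := {z : ℂ | ∃ t : ℝ, 0 < t ∧ z = t * c}

/-- A ray: a subset of `ℂ∖{0}` of the form `ℝ_{>0}·e^{iπφ}`. -/
def IsRay (r : Set ℂ) : Prop := ∃ c : ℂ, c ≠ 0 ∧ r = rayThrough c

/-- The Stokes rays of the connection determined by `Z = diag(z₁,…,zₙ)` are the
rays `ℝ_{>0}·(z_i − z_j)` for `i ≠ j`. -/
def IsStokesRay {n : ℕ} (z : Fin n → ℂ) (ℓ : Set ℂ) : Prop :=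
  ∃ i j : Fin n, i ≠ j ∧ ℓ = rayThrough (z i - z j)

/-- A ray is admissible if it is not a Stokes ray. -/
def IsAdmissibleRay {n : ℕ} (z : Fin n → ℂ) (r : Set ℂ) : Prop :=
  IsRay r ∧ ¬ IsStokesRay z r

/-- The half-plane `H_r = {u·v : u ∈ r, Re v > 0}` determined by a ray `r`. -/
def halfPlane (r : Set ℂ) : Set ℂ :=
  {z : ℂ | ∃ u ∈ r, ∃ v : ℂ, 0 < v.re ∧ z = u * v}

/-- The closed convex sector `Σ̄(r,r′)` bounded by the rays `r` and `r′`. -/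
def sector (r r' : Set ℂ) : Set ℂ :=
  {z : ℂ | ∃ u ∈ r, ∃ u' ∈ r', ∃ a b : ℝ,
    0 ≤ a ∧ 0 ≤ b ∧ ¬(a = 0 ∧ b = 0) ∧ z = a * u + b * u'}

/-- The matrix `exp(Z/t)` for `Z = diag(z₁,…,zₙ)`: the diagonal matrix with
entries `exp(zᵢ/t)`. -/
noncomputable def expZt {n : ℕ} (z : Fin n → ℂ) (t : ℂ) : Matrix (Fin n) (Fin n) ℂ :=
  Matrix.diagonal fun i => Complex.exp (z i / t)

/-- `Y` is the canonical fundamental solution of `Y′ = (Z/t² + f/t)·Y` on the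
half-plane `H_r`: it is holomorphic and `GLₙ`-valued there, solves the ODE, and
`Y(t)·exp(Z/t) → 1` as `t → 0` in `H_r`. -/
def IsCanonicalSolution {n : ℕ} (z : Fin n → ℂ) (f : Matrix (Fin n) (Fin n) ℂ)
    (r : Set ℂ) (Y : ℂ → Matrix (Fin n) (Fin n) ℂ) : Prop :=
  (∀ t ∈ halfPlane r, IsUnit (Y t)) ∧
  (∀ t ∈ halfPlane r, ∀ i j : Fin n,
    HasDerivAt (fun s => Y s i j)
      ((((t ^ 2)⁻¹ • Matrix.diagonal z + t⁻¹ • f) * Y t) i j) t) ∧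
  (∀ i j : Fin n,
    Tendsto (fun t => (Y t * expZt z t) i j) (𝓝[halfPlane r] 0)
      (𝓝 (if i = j then (1 : ℂ) else 0)))

/-- The half-plane of the ray through `c` in real coordinates: `Re (t * conj c) > 0`. -/
theorem mem_halfPlane_rayThrough {c : ℂ} (hc : c ≠ 0) (t : ℂ) :
    t ∈ halfPlane (rayThrough c) ↔ 0 < c.re * t.re + c.im * t.im := by
  have hpos : 0 < c.re * c.re + c.im * c.im := by
    simpa [Complex.normSq_apply] using Complex.normSq_pos.2 hc
  constructor
  · rintro ⟨_, ⟨s, hs, rfl⟩, v, hv, rfl⟩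
    have : 0 < s * v.re * (c.re * c.re + c.im * c.im) := by positivity
    simp only [Complex.mul_re, Complex.mul_im, Complex.ofReal_re, Complex.ofReal_im]
    linarith
  · intro h
    refine ⟨c, ⟨1, one_pos, by simp⟩, t / c, ?_, by field_simp⟩
    rw [Complex.div_re, ← add_div]
    refine div_pos ?_ (Complex.normSq_pos.2 hc)
    linarith

/-- Two rays that are not opposite have linearly independent directions or coincide. -/
theorem det_ne_zero_or_eq_mul {c c' : ℂ} (hc : c ≠ 0) (hc' : c' ≠ 0)
    (h : rayThrough c ≠ Neg.neg '' rayThrough c') :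
    c.re * c'.im - c.im * c'.re ≠ 0 ∨ ∃ k : ℝ, 0 < k ∧ c' = k * c := by
  by_cases hD : c.re * c'.im - c.im * c'.re = 0
  · right
    have hpos : 0 < c.re * c.re + c.im * c.im := by
      simpa [Complex.normSq_apply] using Complex.normSq_pos.2 hc
    set k : ℝ := (c.re * c'.re + c.im * c'.im) / (c.re * c.re + c.im * c.im) with hk
    have hkc : c' = k * c := by
      apply Complex.ext
      · simp only [Complex.mul_re, Complex.ofReal_re, Complex.ofReal_im, hk,
          zero_mul, sub_zero]
        rw [div_mul_eq_mul_div, eq_div_iff hpos.ne']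
        linear_combination (-c.im) * hD
      · simp only [Complex.mul_im, Complex.ofReal_re, Complex.ofReal_im, hk,
          zero_mul, add_zero]
        rw [div_mul_eq_mul_div, eq_div_iff hpos.ne']
        linear_combination c.re * hD
    refine ⟨k, ?_, hkc⟩
    by_contra hk0
    have hkne : k ≠ 0 := by
      intro h0
      exact hc' (by rw [hkc, h0]; simp)
    have hkneg : k < 0 := lt_of_le_of_ne (not_lt.1 hk0) hkne
    have hkC : (k : ℂ) ≠ 0 := by exact_mod_cast hkne
    apply h
    ext w
    constructor
    · rintro ⟨s, hs, rfl⟩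
      refine ⟨-(s * c), ⟨s / -k, div_pos hs (by linarith), ?_⟩, by simp⟩
      rw [hkc]
      push_cast
      field_simp
    · rintro ⟨_, ⟨s, hs, rfl⟩, rfl⟩
      refine ⟨s * -k, mul_pos hs (by linarith), ?_⟩
      rw [hkc]
      push_cast
      ring
  · exact Or.inl hD

/-- When `c` and `c'` are independent, the pairings with them can be prescribed. -/
theorem exists_pairing_eq {c c' : ℂ} (hD : c.re * c'.im - c.im * c'.re ≠ 0) (α β : ℝ) :
    ∃ d : ℂ, c.re * d.re + c.im * d.im = α ∧ c'.re * d.re + c'.im * d.im = β := by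
  refine ⟨⟨(α * c'.im - β * c.im) / (c.re * c'.im - c.im * c'.re),
    (c.re * β - c'.re * α) / (c.re * c'.im - c.im * c'.re)⟩, ?_, ?_⟩ <;>
  · dsimp only
    rw [← mul_div_assoc, ← mul_div_assoc, ← add_div, div_eq_iff hD]
    ring

theorem halfPlane_inter_nonempty {c c' : ℂ} (hc : c ≠ 0) (hc' : c' ≠ 0)
    (h : rayThrough c ≠ Neg.neg '' rayThrough c') :
    (halfPlane (rayThrough c) ∩ halfPlane (rayThrough c')).Nonempty := by
  rcases det_ne_zero_or_eq_mul hc hc' h with hD | ⟨k, hk, rfl⟩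
  · obtain ⟨d, h1, h2⟩ := exists_pairing_eq hD 1 1
    refine ⟨d, (mem_halfPlane_rayThrough hc d).2 ?_, (mem_halfPlane_rayThrough hc' d).2 ?_⟩ <;>
      linarith
  · have hpos : 0 < c.re * c.re + c.im * c.im := by
      simpa [Complex.normSq_apply] using Complex.normSq_pos.2 hc
    refine ⟨c, (mem_halfPlane_rayThrough hc c).2 hpos, (mem_halfPlane_rayThrough hc' c).2 ?_⟩
    have := mul_pos hk hpos
    simp only [Complex.mul_re, Complex.mul_im, Complex.ofReal_re, Complex.ofReal_im]
    linarith

/-- The dual cone of `H_r ∩ H_r'` is contained in the closed sector spanned by `r` and `r'`. -/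
theorem mem_sector_of_forall_nonneg {c c' w : ℂ} (hc : c ≠ 0) (hc' : c' ≠ 0) (hw : w ≠ 0)
    (h : rayThrough c ≠ Neg.neg '' rayThrough c')
    (hdual : ∀ d ∈ halfPlane (rayThrough c) ∩ halfPlane (rayThrough c'),
      0 ≤ w.re * d.re + w.im * d.im) :
    w ∈ sector (rayThrough c) (rayThrough c') := by
  simp only [Set.mem_inter_iff, mem_halfPlane_rayThrough hc, mem_halfPlane_rayThrough hc'] at hdual
  have hself : ∀ x : ℂ, x ∈ rayThrough x := fun x => ⟨1, one_pos, by simp⟩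
  rcases det_ne_zero_or_eq_mul hc hc' h with hD | ⟨k, hk, rfl⟩
  · set D := c.re * c'.im - c.im * c'.re with hDdef
    obtain ⟨a, b, hre, him⟩ : ∃ a b : ℝ,
        w.re = a * c.re + b * c'.re ∧ w.im = a * c.im + b * c'.im := by
      refine ⟨(w.re * c'.im - w.im * c'.re) / D, (c.re * w.im - c.im * w.re) / D, ?_, ?_⟩ <;>
      · field_simp
        rw [hDdef]
        ring
    have hwab : w = a * c + b * c' := by
      apply Complex.ext <;> simp [hre, him]
    have key : ∀ α β : ℝ, 0 < α → 0 < β → 0 ≤ a * α + b * β := by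
      intro α β hα hβ
      obtain ⟨d, h1, h2⟩ := exists_pairing_eq hD α β
      have := hdual d ⟨by rw [h1]; exact hα, by rw [h2]; exact hβ⟩
      rw [hre, him] at this
      rw [← h1, ← h2]
      linarith
    have ha : 0 ≤ a := by
      by_contra! ha
      have := key ((|b| + 1) / -a) 1 (div_pos (by positivity) (by linarith)) one_pos
      have e : a * ((|b| + 1) / -a) = -(|b| + 1) := by
        rw [div_neg, mul_neg, mul_div_cancel₀ _ ha.ne]
      rw [e] at this
      linarith [le_abs_self b]
    have hb : 0 ≤ b := by
      by_contra! hb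
      have := key 1 ((|a| + 1) / -b) one_pos (div_pos (by positivity) (by linarith))
      have e : b * ((|a| + 1) / -b) = -(|a| + 1) := by
        rw [div_neg, mul_neg, mul_div_cancel₀ _ hb.ne]
      rw [e] at this
      linarith [le_abs_self a]
    refine ⟨c, hself c, c', hself c', a, b, ha, hb, ?_, hwab⟩
    rintro ⟨rfl, rfl⟩
    exact hw (by simpa using hwab)
  · have hpos : 0 < c.re * c.re + c.im * c.im := by
      simpa [Complex.normSq_apply] using Complex.normSq_pos.2 hc
    set p := w.re * c.re + w.im * c.im with hp
    set q := w.im * c.re - w.re * c.im with hq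
    have key : ∀ y : ℝ, 0 ≤ p + y * q := by
      intro y
      have hre : c.re * (c.re - y * c.im) + c.im * (c.im + y * c.re) =
        c.re * c.re + c.im * c.im := by ring
      have := hdual ⟨c.re - y * c.im, c.im + y * c.re⟩ ⟨by rw [hre]; exact hpos, by
        simp only [Complex.mul_re, Complex.mul_im, Complex.ofReal_re, Complex.ofReal_im]
        linarith [mul_pos hk hpos]⟩
      simp only at this
      rw [hp, hq]
      linarith
    have hq0 : q = 0 := by
      by_contra hq0
      have := key (-(p + 1) / q)
      rw [div_mul_cancel₀ _ hq0] at this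
      linarith
    have hp0 : 0 ≤ p := by simpa using key 0
    have hwp : w = ((p / (c.re * c.re + c.im * c.im) : ℝ) : ℂ) * c := by
      apply Complex.ext
      · simp only [Complex.mul_re, Complex.ofReal_re, Complex.ofReal_im, zero_mul, sub_zero]
        rw [div_mul_eq_mul_div, eq_div_iff hpos.ne']
        linear_combination (-c.re) * hp + c.im * hq - c.im * hq0
      · simp only [Complex.mul_im, Complex.ofReal_re, Complex.ofReal_im, zero_mul, add_zero]
        rw [div_mul_eq_mul_div, eq_div_iff hpos.ne']
        linear_combination (-c.im) * hp - c.re * hq + c.re * hq0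
    refine ⟨c, hself c, k * c, hself _, p / (c.re * c.re + c.im * c.im), 0,
      div_nonneg hp0 hpos.le, le_rfl, ?_, by simpa using hwp⟩
    rintro ⟨h0, -⟩
    exact hw (by rw [hwp, h0]; simp)

theorem isOpen_halfPlane_rayThrough {c : ℂ} (hc : c ≠ 0) : IsOpen (halfPlane (rayThrough c)) := by
  have : halfPlane (rayThrough c) = {t : ℂ | 0 < c.re * t.re + c.im * t.im} :=
    Set.ext (mem_halfPlane_rayThrough hc)
  rw [this]
  exact isOpen_lt (by fun_prop) (by fun_prop)

theorem convex_halfPlane_rayThrough {c : ℂ} (hc : c ≠ 0) :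
    Convex ℝ (halfPlane (rayThrough c)) := by
  intro x hx y hy a b ha hb hab
  rw [mem_halfPlane_rayThrough hc] at hx hy ⊢
  simp only [Complex.add_re, Complex.add_im, Complex.real_smul, Complex.mul_re, Complex.mul_im,
    Complex.ofReal_re, Complex.ofReal_im]
  rcases ha.eq_or_lt with rfl | ha
  · obtain rfl : b = 1 := by linarith
    linarith
  · nlinarith [mul_pos ha hx, mul_nonneg hb hy.le]

/-- Approaching `0` radially inside a half-plane. -/
theorem tendsto_ofReal_mul_halfPlane {c d : ℂ} (hc : c ≠ 0)
    (hd : d ∈ halfPlane (rayThrough c)) :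
    Tendsto (fun s : ℝ => (s : ℂ) * d) (𝓝[>] 0) (𝓝[halfPlane (rayThrough c)] 0) := by
  refine tendsto_nhdsWithin_iff.2 ⟨?_, ?_⟩
  · have : Continuous fun s : ℝ => (s : ℂ) * d := by fun_prop
    simpa using (this.tendsto 0).mono_left nhdsWithin_le_nhds
  · filter_upwards [self_mem_nhdsWithin] with s hs
    rw [mem_halfPlane_rayThrough hc] at hd ⊢
    have := mul_pos (Set.mem_Ioi.1 hs) hd
    simp only [Complex.mul_re, Complex.mul_im, Complex.ofReal_re, Complex.ofReal_im]
    linarith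

section MatrixNorm

attribute [local instance] Matrix.linftyOpNormedRing Matrix.linftyOpNormedAlgebra

/-- Two matrix solutions of the same linear ODE on a convex open set, the first of them
invertible, differ by a constant right factor. -/
theorem exists_eq_mul_of_hasDerivAt {n : ℕ} {S : Set ℂ} (hS : IsOpen S) (hconv : Convex ℝ S)
    {A Y Y' : ℂ → Matrix (Fin n) (Fin n) ℂ} (hunit : ∀ t ∈ S, IsUnit (Y t))
    (hY : ∀ t ∈ S, ∀ i j, HasDerivAt (fun s => Y s i j) ((A t * Y t) i j) t)
    (hY' : ∀ t ∈ S, ∀ i j, HasDerivAt (fun s => Y' s i j) ((A t * Y' t) i j) t) :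
    ∃ C : Matrix (Fin n) (Fin n) ℂ, ∀ t ∈ S, Y' t = Y t * C := by
  have hmat : ∀ {X : ℂ → Matrix (Fin n) (Fin n) ℂ} {X' t},
      (∀ i j, HasDerivAt (fun s => X s i j) (X' i j) t) → HasDerivAt X X' t := by
    intro X X' t h
    exact hasDerivAt_pi.2 fun i => hasDerivAt_pi.2 fun j => h i j
  have hder : ∀ t ∈ S, HasDerivAt (fun s => Ring.inverse (Y s) * Y' s) 0 t := by
    intro t ht
    obtain ⟨u, hu⟩ := hunit t ht
    have hinv := hasFDerivAt_ringInverse (𝕜 := ℂ) u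
    rw [hu] at hinv
    have h1 := hinv.comp_hasDerivAt t (hmat (hY t ht))
    refine (h1.mul (hmat (hY' t ht))).congr_deriv ?_
    rw [Function.comp_apply, ← hu]
    simp [mul_assoc]
  obtain ⟨C, hC⟩ : ∃ C, ∀ t ∈ S, Ring.inverse (Y t) * Y' t = C :=
    hS.exists_is_const_of_deriv_eq_zero hconv.isPreconnected
      (fun t ht => (hder t ht).differentiableAt.differentiableWithinAt)
      (fun t ht => (hder t ht).deriv)
  refine ⟨C, fun t ht => ?_⟩
  rw [← hC t ht, ← mul_assoc, Ring.mul_inverse_cancel _ (hunit t ht), one_mul]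

/-- If `M`, `M * X` tend to `1` entrywise and `M` is invertible, then `X` tends to `1` entrywise. -/
theorem tendsto_one_of_mul_tendsto_one {n : ℕ} {α : Type*} {l : Filter α}
    {M X : α → Matrix (Fin n) (Fin n) ℂ} (hunit : ∀ᶠ s in l, IsUnit (M s))
    (hM : ∀ i j, Tendsto (fun s => M s i j) l (𝓝 (if i = j then (1 : ℂ) else 0)))
    (hMX : ∀ i j, Tendsto (fun s => (M s * X s) i j) l (𝓝 (if i = j then (1 : ℂ) else 0)))
    (i j : Fin n) : Tendsto (fun s => X s i j) l (𝓝 (if i = j then (1 : ℂ) else 0)) := by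
  have hmat : ∀ {W : α → Matrix (Fin n) (Fin n) ℂ},
      (∀ i j, Tendsto (fun s => W s i j) l (𝓝 (if i = j then (1 : ℂ) else 0))) →
      Tendsto W l (𝓝 1) := by
    intro W h
    refine tendsto_pi_nhds.2 fun i => tendsto_pi_nhds.2 fun j => ?_
    simpa [Matrix.one_apply] using h i j
  have hinv : Tendsto (fun s => Ring.inverse (M s)) l (𝓝 1) := by
    have := (NormedRing.inverse_continuousAt (1 : (Matrix (Fin n) (Fin n) ℂ)ˣ)).tendsto
    simp only [Units.val_one, Ring.inverse_one] at this
    exact this.comp (hmat hM)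
  have hX : Tendsto X l (𝓝 1) := by
    have := hinv.mul (hmat hMX)
    rw [one_mul] at this
    refine this.congr' ?_
    filter_upwards [hunit] with s hs
    rw [← mul_assoc, Ring.inverse_mul_cancel _ hs, one_mul]
  simpa [Matrix.one_apply] using tendsto_pi_nhds.1 (tendsto_pi_nhds.1 hX i) j

end MatrixNorm

theorem expZt_mul_expZt_neg {n : ℕ} (z : Fin n → ℂ) (t : ℂ) : expZt z t * expZt (-z) t = 1 := by
  simp [expZt, Matrix.diagonal_mul_diagonal, ← Complex.exp_add, neg_div]

/-- If `exp (w / t)` tends to `0` along the radius through `d`, then the real pairing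
of `w` and `d` is nonpositive. -/
theorem pairing_nonpos_of_tendsto_exp {w d : ℂ} (hd : d ≠ 0)
    (h : Tendsto (fun s : ℝ => Complex.exp (w / (s * d))) (𝓝[>] 0) (𝓝 0)) :
    w.re * d.re + w.im * d.im ≤ 0 := by
  by_contra! hpos
  have hre : 0 < (w / d).re := by
    rw [Complex.div_re, ← add_div]
    exact div_pos hpos (Complex.normSq_pos.2 hd)
  have hsmall := h.norm.eventually_lt_const (by simp : ‖(0 : ℂ)‖ < 1)
  obtain ⟨s, hs1, hs⟩ := (hsmall.and self_mem_nhdsWithin).exists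
  have e : w / (s * d) = ((s⁻¹ : ℝ) : ℂ) * (w / d) := by
    push_cast
    rw [mul_comm (s : ℂ) d, ← div_div, div_eq_mul_inv (w / d), mul_comm]
  rw [e, Complex.norm_exp, Real.exp_lt_one_iff, Complex.re_ofReal_mul] at hs1
  linarith [mul_pos (inv_pos.2 (Set.mem_Ioi.1 hs)) hre]

/-- **Agreement of canonical solutions across sectors without Stokes rays** (case
`G = GLₙ(ℂ)`): if `r`, `r′` are admissible rays with `r ≠ −r′` and the closed
sector `Σ̄(r,r′)` contains no Stokes ray, then the canonical fundamental
solutions agree on `H_r ∩ H_{r′}`. -/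
theorem canonicalSolutions_eqOn_of_no_stokesRay {n : ℕ} (hn : 1 ≤ n)
    (z : Fin n → ℂ) (hz : ∀ i j : Fin n, i ≠ j → z i ≠ z j)
    (f : Matrix (Fin n) (Fin n) ℂ) (hf : ∀ i, f i i = 0)
    (r r' : Set ℂ) (hr : IsAdmissibleRay z r) (hr' : IsAdmissibleRay z r')
    (hrr' : r ≠ Neg.neg '' r')
    (hsec : ∀ ℓ : Set ℂ, IsStokesRay z ℓ → ¬ ℓ ⊆ sector r r')
    (Y Y' : ℂ → Matrix (Fin n) (Fin n) ℂ)
    (hY : IsCanonicalSolution z f r Y) (hY' : IsCanonicalSolution z f r' Y') :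
    Set.EqOn Y Y' (halfPlane r ∩ halfPlane r') := by
  obtain ⟨⟨c, hc, rfl⟩, -⟩ := hr
  obtain ⟨⟨c', hc', rfl⟩, -⟩ := hr'
  obtain ⟨hYu, hYd, hYt⟩ := hY
  obtain ⟨-, hYd', hYt'⟩ := hY'
  obtain ⟨C, hC⟩ := exists_eq_mul_of_hasDerivAt
    ((isOpen_halfPlane_rayThrough hc).inter (isOpen_halfPlane_rayThrough hc'))
    ((convex_halfPlane_rayThrough hc).inter (convex_halfPlane_rayThrough hc'))
    (fun t ht => hYu t ht.1) (fun t ht => hYd t ht.1) (fun t ht => hYd' t ht.2)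
  have hlim : ∀ d ∈ halfPlane (rayThrough c) ∩ halfPlane (rayThrough c'), ∀ i j,
      Tendsto (fun s : ℝ => C i j * Complex.exp ((z j - z i) / (s * d))) (𝓝[>] 0)
        (𝓝 (if i = j then (1 : ℂ) else 0)) := by
    intro d hd i j
    have ht := tendsto_ofReal_mul_halfPlane hc hd.1
    have ht' := tendsto_ofReal_mul_halfPlane hc' hd.2
    have hmem := (tendsto_nhdsWithin_iff.1 ht).2
    have hmem' := (tendsto_nhdsWithin_iff.1 ht').2
    have := tendsto_one_of_mul_tendsto_one (l := 𝓝[>] (0 : ℝ))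
      (M := fun s : ℝ => Y (s * d) * expZt z (s * d))
      (X := fun s : ℝ => expZt (-z) (s * d) * C * expZt z (s * d)) ?_
      (fun i j => (hYt i j).comp ht) ?_ i j
    · refine this.congr fun s => ?_
      simp only [expZt, Matrix.mul_diagonal, Matrix.diagonal_mul, Pi.neg_apply]
      rw [sub_div, sub_eq_add_neg, Complex.exp_add, neg_div]
      ring
    · filter_upwards [hmem] with s hs
      exact (hYu _ hs).mul (IsUnit.of_mul_eq_one _ (expZt_mul_expZt_neg z _))
    · intro i j
      refine ((hYt' i j).comp ht').congr' ?_
      filter_upwards [hmem, hmem'] with s hs hs'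
      have e : Y (s * d) * expZt z (s * d) * (expZt (-z) (s * d) * C * expZt z (s * d)) =
          Y' (s * d) * expZt z (s * d) := by
        rw [hC _ ⟨hs, hs'⟩]
        simp only [mul_assoc]
        rw [← mul_assoc (expZt z _) (expZt (-z) _), expZt_mul_expZt_neg, one_mul]
      simp only [Function.comp_apply, e]
  have hC1 : C = 1 := by
    ext i j
    rw [Matrix.one_apply]
    split_ifs with hij
    · subst hij
      obtain ⟨d, hd⟩ := halfPlane_inter_nonempty hc hc' hrr'
      have := hlim d hd i i
      simp only [sub_self, zero_div, Complex.exp_zero, mul_one, if_true] at this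
      exact tendsto_nhds_unique tendsto_const_nhds this
    · by_contra hCij
      refine hsec _ ⟨i, j, hij, rfl⟩ ?_
      have hw : z i - z j ∈ sector (rayThrough c) (rayThrough c') := by
        refine mem_sector_of_forall_nonneg hc hc' (sub_ne_zero.2 (hz i j hij)) hrr' ?_
        intro d hd
        have hd0 : d ≠ 0 := by
          rintro rfl
          simpa using (mem_halfPlane_rayThrough hc 0).1 hd.1
        have h0 := (hlim d hd i j).const_mul (C i j)⁻¹
        simp only [if_neg hij, mul_zero, inv_mul_cancel_left₀ hCij] at h0
        have := pairing_nonpos_of_tendsto_exp hd0 h0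
        simp only [Complex.sub_re, Complex.sub_im] at this ⊢
        linarith
      obtain ⟨u, hu, u', hu', a, b, ha, hb, hab, hw⟩ := hw
      rintro _ ⟨s, hs, rfl⟩
      refine ⟨u, hu, u', hu', s * a, s * b, by positivity, by positivity, ?_, ?_⟩
      · rintro ⟨h1, h2⟩
        exact hab ⟨(mul_eq_zero.1 h1).resolve_left hs.ne', (mul_eq_zero.1 h2).resolve_left hs.ne'⟩
      · rw [hw]
        push_cast
        ring
  intro t ht
  rw [hC t ht, hC1, mul_one]
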